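/- Let R be a commutative Noetherian ring, p₁, …, pₙ distinct primes and r₁, …, rₙ positive integers such that for each i, p_i^{r_i} ≠ p_i^{r_i − 1} and Ass_R(R/p_i^{r_i}) = {p_i}. Then the submodule p₁^{r₁} ⊕ ⋯ ⊕ pₙ^{rₙ} of the free module Rⁿ has generalized prime ideal factorization P_{Rⁿ}(p₁^{r₁} ⊕ ⋯ ⊕ pₙ^{rₙ}) = p₁^{r₁}⋯pₙ^{rₙ}. -/

import Mathlib

variable {R : Type*} [CommRing R] {M : Type*} [AddCommGroup M] [Module R M]

/-- The colon submodule `(N :_M I) = {x ∈ M | I • x ⊆ N}`. -/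
def colonSubmodule (N : Submodule R M) (I : Ideal R) : Submodule R M where
  carrier := {x | ∀ a ∈ I, a • x ∈ N}
  add_mem' := fun hx hy a ha => by simpa [smul_add] using N.add_mem (hx a ha) (hy a ha)
  zero_mem' := fun a _ => by simp
  smul_mem' := fun c x hx a ha => by
    rw [smul_comm]
    exact N.smul_mem c (hx a ha)

/-- `K` is a `p`-prime extension of `N`, i.e. `N` is a `p`-prime submodule of `K`. -/
def IsPrimeExt (p : Ideal R) (N K : Submodule R M) : Prop :=
  N < K ∧ N.colon K = p ∧ ∀ a : R, ∀ x ∈ K, a • x ∈ N → x ∈ N ∨ a ∈ p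

/-- The associated primes of `T / N` for submodules `N ≤ T ≤ M`. -/
def assOf (R : Type*) {M : Type*} [CommRing R] [AddCommGroup M] [Module R M]
    (N T : Submodule R M) : Set (Ideal R) :=
  associatedPrimes R ↥(T.map N.mkQ)

/-- `K` is a maximal `p`-prime extension of `N` inside `T`. -/
def IsMaximalPrimeExtIn (T : Submodule R M) (p : Ideal R) (N K : Submodule R M) : Prop :=
  K ≤ T ∧ IsPrimeExt p N K ∧ ∀ L ≤ T, IsPrimeExt p N L → ¬ K < L

/-- `K` is a regular `p`-prime extension of `N` inside `T`: a maximal `p`-prime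
extension where `p` is a maximal element of `Ass (T/N)`. -/
def IsRegularPrimeExtIn (T : Submodule R M) (p : Ideal R) (N K : Submodule R M) : Prop :=
  IsMaximalPrimeExtIn T p N K ∧ Maximal (· ∈ assOf R N T) p

/-- A regular prime extension (RPE) filtration inside `T` with primes `p i`. -/
def IsRPEFiltrationIn (T : Submodule R M) {n : ℕ}
    (F : Fin (n + 1) → Submodule R M) (p : Fin n → Ideal R) : Prop :=
  ∀ i : Fin n, IsRegularPrimeExtIn T (p i) (F i.castSucc) (F i.succ)

/-- The generalized prime ideal factorization of `N` in `T` is given by the multiset `s`: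
there is an RPE filtration of `T` over `N` whose multiset of primes is `s`. -/
def HasGPIF (N T : Submodule R M) (s : Multiset (Ideal R)) : Prop :=
  ∃ (n : ℕ) (F : Fin (n + 1) → Submodule R M) (p : Fin n → Ideal R),
    F 0 = N ∧ F (Fin.last n) = T ∧ IsRPEFiltrationIn T F p ∧ (List.ofFn p : Multiset (Ideal R)) = s

theorem HasGPIF.cons_aux {R : Type*} [CommRing R] {M : Type*} [AddCommGroup M] [Module R M]
    {N K T : Submodule R M} {q : Ideal R} {s : Multiset (Ideal R)}
    (h : IsRegularPrimeExtIn T q N K) (hK : HasGPIF K T s) : HasGPIF N T (q ::ₘ s) := by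
  obtain ⟨n, F, p, h0, hl, hF, hs⟩ := hK
  refine ⟨n + 1, Fin.cons N F, Fin.cons q p, rfl, ?_, ?_, ?_⟩
  · rw [← Fin.succ_last, Fin.cons_succ, hl]
  · intro i
    refine Fin.cases ?_ (fun j => ?_) i
    · simpa [h0] using h
    · have := hF j
      rw [← Fin.succ_castSucc]
      simpa only [Fin.cons_succ] using this
  · rw [List.ofFn_succ]
    simp only [Fin.cons_zero, Fin.cons_succ]
    rw [← Multiset.cons_coe, hs]

theorem mem_assOf_top_iff {R : Type*} [CommRing R] [IsNoetherianRing R] {M : Type*}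
    [AddCommGroup M] [Module R M] (N : Submodule R M) (q : Ideal R) :
    q ∈ assOf R N ⊤ ↔ q.IsPrime ∧ ∃ x : M, ∀ a, a ∈ q ↔ a • x ∈ N := by
  unfold assOf
  rw [AssociatedPrimes.mem_iff, isAssociatedPrime_iff]
  refine and_congr_right fun _ => ?_
  constructor
  · rintro ⟨⟨y, hy⟩, rfl⟩
    obtain ⟨x, -, rfl⟩ := hy
    refine ⟨x, fun a => ?_⟩
    rw [Submodule.mem_colon_singleton, Submodule.mem_bot, ← Subtype.coe_inj]
    simp only [Submodule.coe_smul, Submodule.coe_zero]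
    rw [← map_smul, Submodule.mkQ_apply, Submodule.Quotient.mk_eq_zero]
  · rintro ⟨x, hx⟩
    refine ⟨⟨N.mkQ x, Submodule.mem_map_of_mem trivial⟩, ?_⟩
    ext a
    rw [Submodule.mem_colon_singleton, Submodule.mem_bot, ← Subtype.coe_inj]
    simp only [Submodule.coe_smul, Submodule.coe_zero]
    rw [← map_smul, Submodule.mkQ_apply, Submodule.Quotient.mk_eq_zero, hx]

theorem regular_step_aux {R : Type*} [CommRing R] [IsNoetherianRing R] {n : ℕ}
    (p Q Q' : Fin n → Ideal R) (hprime : ∀ i, (p i).IsPrime) (i : Fin n)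
    (hprim : ∀ j a b, a * b ∈ Q j → b ∈ Q j ∨ a ∈ p j)
    (hQ' : ∀ j, j ≠ i → Q' j = Q j)
    (hi : ∀ x, x ∈ Q' i ↔ ∀ a ∈ p i, a * x ∈ Q i)
    (hlt : ∃ x ∈ Q' i, x ∉ Q i)
    (hmax : ∀ j, j ≠ i → Q j ≠ ⊤ → ¬ p i ≤ p j) :
    IsRegularPrimeExtIn ⊤ (p i) (Submodule.pi Set.univ Q : Submodule R (Fin n → R))
      (Submodule.pi Set.univ Q') := by
  have hle : (Submodule.pi Set.univ Q : Submodule R (Fin n → R)) ≤ Submodule.pi Set.univ Q' := by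
    intro x hx j _
    by_cases hj : j = i
    · subst hj
      exact (hi _).2 fun a _ => (Q j).mul_mem_left _ (hx j trivial)
    · change x j ∈ Q' j
      rw [hQ' j hj]; exact hx j trivial
  obtain ⟨z, hz, hzn⟩ := hlt
  have hZ : (Pi.single i z : Fin n → R) ∈ (Submodule.pi Set.univ Q' : Submodule R (Fin n → R)) := by
    intro j _
    by_cases hj : j = i
    · subst hj; simpa using hz
    · simp [hj]
  have hZn : (Pi.single i z : Fin n → R) ∉ (Submodule.pi Set.univ Q : Submodule R (Fin n → R)) := by
    intro h
    exact hzn (by simpa using h i trivial)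
  have hp : ∀ a : R, ∀ x ∈ (Submodule.pi Set.univ Q' : Submodule R (Fin n → R)),
      a • x ∈ (Submodule.pi Set.univ Q : Submodule R (Fin n → R)) →
      x ∈ (Submodule.pi Set.univ Q : Submodule R (Fin n → R)) ∨ a ∈ p i := by
    intro a x hx hax
    by_cases ha : a ∈ p i
    · exact Or.inr ha
    · refine Or.inl fun j _ => ?_
      by_cases hj : j = i
      · subst hj
        exact (hprim j a (x j) (hax j trivial)).resolve_right ha
      · change x j ∈ Q j
        rw [← hQ' j hj]; exact hx j trivial
  have hsm : ∀ a ∈ p i, ∀ x ∈ (Submodule.pi Set.univ Q' : Submodule R (Fin n → R)),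
      a • x ∈ (Submodule.pi Set.univ Q : Submodule R (Fin n → R)) := by
    intro a ha x hx j _
    by_cases hj : j = i
    · subst hj
      exact (hi _).1 (hx j trivial) a ha
    · have : x j ∈ Q' j := hx j trivial
      rw [hQ' j hj] at this
      exact (Q j).mul_mem_left _ this
  refine ⟨⟨le_top, ⟨lt_of_le_not_ge hle fun h => hZn (h hZ), ?_, hp⟩, ?_⟩, ?_, ?_⟩
  · ext a
    rw [Submodule.mem_colon]
    exact ⟨fun h => (hp a _ hZ (h _ hZ)).resolve_left hZn, fun h x hx => hsm a h x hx⟩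
  · rintro L - ⟨-, hL, -⟩ hKL
    refine hKL.not_ge fun x hx j _ => ?_
    have hax : ∀ a ∈ p i, a * x j ∈ Q j := by
      intro a ha
      rw [← hL, Submodule.mem_colon] at ha
      exact ha x hx j trivial
    by_cases hj : j = i
    · subst hj
      exact (hi _).2 hax
    · change x j ∈ Q' j
      rw [hQ' j hj]
      by_cases ht : Q j = ⊤
      · rw [ht]; trivial
      · obtain ⟨a, ha, han⟩ := Set.not_subset.1 (hmax j hj ht)
        exact (hprim j a (x j) (hax a ha)).resolve_right han
  · exact (mem_assOf_top_iff _ _).2 ⟨hprime i, _, fun a =>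
      ⟨fun h => hsm a h _ hZ, fun h => (hp a _ hZ h).resolve_left hZn⟩⟩
  · intro q hq hpq
    obtain ⟨hqp, x, hx⟩ := (mem_assOf_top_iff _ _).1 hq
    have hxn : x ∉ (Submodule.pi Set.univ Q : Submodule R (Fin n → R)) := by
      intro h
      exact hqp.ne_top ((Ideal.eq_top_iff_one q).2 ((hx 1).2 (by simpa using h)))
    have : ∃ j, x j ∉ Q j := by
      by_contra! h
      exact hxn fun j _ => h j
    obtain ⟨j, hj⟩ := this
    have hqj : q ≤ p j := fun a ha => (hprim j a (x j) ((hx a).1 ha j trivial)).resolve_left hj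
    by_cases hji : j = i
    · subst hji; exact hqj
    · exact absurd (le_trans hpq hqj) (hmax j hji fun h => hj (by rw [h]; trivial))

theorem gpif_pi_pow_aux {R : Type*} [CommRing R] [IsNoetherianRing R]
    {n : ℕ} (p : Fin n → Ideal R) (hprime : ∀ i, (p i).IsPrime)
    (hdist : Function.Injective p) (r : Fin n → ℕ)
    (hpow : ∀ i, p i ^ r i ≠ p i ^ (r i - 1))
    (hprim : ∀ j a b, a * b ∈ p j ^ r j → b ∈ p j ^ r j ∨ a ∈ p j) (m : ℕ) :
    ∀ k : Fin n → ℕ, (∀ i, k i ≤ r i) → ∑ i, (r i - k i) = m →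
    HasGPIF (Submodule.pi Set.univ
        (fun i => (p i ^ r i : Ideal R).colon ((p i ^ k i : Ideal R) : Set R)) :
        Submodule R (Fin n → R)) ⊤
      (∑ i, Multiset.replicate (r i - k i) (p i)) := by
  induction m with
  | zero =>
    intro k hk hm
    have h0 : ∀ i, r i - k i = 0 := by simpa using hm
    refine ⟨0, fun _ => ⊤, Fin.elim0, ?_, rfl, fun i => i.elim0, ?_⟩
    · symm
      rw [eq_top_iff]
      intro x _ i _
      have : k i = r i := by have := h0 i; have := hk i; omega
      change x i ∈ (p i ^ r i : Ideal R).colon ((p i ^ k i : Ideal R) : Set R)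
      rw [this]
      exact Submodule.mem_colon.2 fun s hs => Ideal.mul_mem_left _ _ hs
    · simp [h0]
  | succ m ih =>
    intro k hk hm
    have hne : (Finset.univ.filter fun i => k i < r i).Nonempty := by
      by_contra h
      rw [Finset.not_nonempty_iff_eq_empty] at h
      have : ∀ i, r i - k i = 0 := fun i => by
        have : i ∉ (Finset.univ.filter fun i => k i < r i) := by rw [h]; simp
        simp at this
        omega
      simp [this] at hm
    obtain ⟨i, him, hi⟩ := Finset.exists_maximalFor p _ hne
    have hki : k i < r i := by simpa using him
    set k' : Fin n → ℕ := Function.update k i (k i + 1) with hk'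
    have hk'i : k' i = k i + 1 := by simp [hk']
    have hk'j : ∀ j, j ≠ i → k' j = k j := fun j hj => by simp [hk', hj]
    have hsub : r i - k i = (r i - k' i) + 1 := by omega
    have e1 : ∑ j, (r j - k j) = ∑ j, (r j - k' j) + 1 := by
      rw [← Finset.add_sum_erase _ _ (Finset.mem_univ i),
        ← Finset.add_sum_erase _ (fun j => r j - k' j) (Finset.mem_univ i)]
      rw [Finset.sum_congr rfl (fun j hj => by rw [← hk'j j (Finset.ne_of_mem_erase hj)])]
      omega
    have e2 : ∑ j, Multiset.replicate (r j - k j) (p j)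
        = p i ::ₘ ∑ j, Multiset.replicate (r j - k' j) (p j) := by
      rw [← Finset.add_sum_erase _ _ (Finset.mem_univ i),
        ← Finset.add_sum_erase _ (fun j => Multiset.replicate (r j - k' j) (p j))
          (Finset.mem_univ i)]
      rw [Finset.sum_congr rfl (fun j hj => by rw [← hk'j j (Finset.ne_of_mem_erase hj)])]
      rw [hsub, Multiset.replicate_succ, Multiset.cons_add]
    rw [e2]
    refine HasGPIF.cons_aux ?_ (ih k' ?_ (by omega))
    · refine regular_step_aux p _ _ hprime i ?_ ?_ ?_ ?_ ?_
      · intro j a b hab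
        by_cases ha : a ∈ p j
        · exact Or.inr ha
        · refine Or.inl (Submodule.mem_colon.2 fun s hs => ?_)
          have := Submodule.mem_colon.1 hab s hs
          rw [smul_eq_mul, mul_assoc] at this
          exact (hprim j _ _ this).resolve_right ha
      · intro j hj
        simp only [hk'j j hj]
      · intro x
        simp only [hk'i]
        constructor
        · intro h a ha
          refine Submodule.mem_colon.2 fun s hs => ?_
          have := Submodule.mem_colon.1 h (s * a) (by
            rw [pow_succ]; exact Ideal.mul_mem_mul hs ha)
          rw [smul_eq_mul] at this ⊢
          convert this using 1; ring
        · intro h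
          refine Submodule.mem_colon.2 fun s hs => ?_
          rw [SetLike.mem_coe, pow_succ] at hs
          induction hs using Submodule.mul_induction_on' with
          | mem_mul_mem s hs a ha =>
            have := Submodule.mem_colon.1 (h a ha) s hs
            rw [smul_eq_mul] at this ⊢
            convert this using 1; ring
          | add y _ z _ hy hz => rw [smul_add]; exact Ideal.add_mem _ hy hz
      · simp only [hk'i]
        by_contra! hcon
        refine hpow i (le_antisymm (Ideal.pow_le_pow_right (by omega)) ?_)
        have h1 : r i - 1 = (r i - 1 - k i) + k i := by omega
        rw [h1, pow_add, Ideal.mul_le]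
        intro x hx s hs
        refine Submodule.mem_colon.1 (hcon x (Submodule.mem_colon.2 fun t ht => ?_)) s hs
        have h2 : r i = (r i - 1 - k i) + (k i + 1) := by omega
        rw [h2, pow_add (p i)]
        exact Ideal.mul_mem_mul hx ht
      · intro j hj ht hle
        have hkj : k j < r j := by
          by_contra h
          have : k j = r j := le_antisymm (hk j) (by omega)
          apply ht
          rw [this, Submodule.colon_eq_top_iff_subset]
        exact hj (hdist (le_antisymm (hi (by simpa using hkj) hle) hle))
    · intro j
      by_cases hj : j = i
      · subst hj; omega
      · rw [hk'j j hj]; exact hk j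

theorem primary_aux {R : Type*} [CommRing R] [IsNoetherianRing R] (I p : Ideal R)
    (h : associatedPrimes R (R ⧸ I) = {p}) (a b : R) (hab : a * b ∈ I) : b ∈ I ∨ a ∈ p := by
  by_cases hb : b ∈ I
  · exact Or.inl hb
  · right
    obtain ⟨P, hP, hle⟩ := exists_le_isAssociatedPrime_of_isNoetherianRing R
      (Ideal.Quotient.mk I b) (fun h => hb (Ideal.Quotient.eq_zero_iff_mem.1 h))
    have : P = p := by
      have : P ∈ associatedPrimes R (R ⧸ I) := hP
      rwa [h] at this
    rw [← this]
    apply hle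
    rw [Submodule.mem_colon_singleton, Submodule.mem_bot]
    exact Ideal.Quotient.eq_zero_iff_mem.2 hab

/-- If `pᵢ^{rᵢ} ≠ pᵢ^{rᵢ−1}` and `Ass (R/pᵢ^{rᵢ}) = {pᵢ}` for distinct primes `pᵢ`, then
the submodule `p₁^{r₁} ⊕ ⋯ ⊕ pₙ^{rₙ}` of `Rⁿ` has generalized prime ideal factorization
`p₁^{r₁}⋯pₙ^{rₙ}`. -/
theorem gpif_pi_pow {R : Type*} [CommRing R] [IsNoetherianRing R]
    {n : ℕ} (p : Fin n → Ideal R) (hprime : ∀ i, (p i).IsPrime)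
    (hdist : Function.Injective p) (r : Fin n → ℕ) (hr : ∀ i, 0 < r i)
    (hpow : ∀ i, p i ^ r i ≠ p i ^ (r i - 1))
    (hass : ∀ i, associatedPrimes R (R ⧸ (p i ^ r i : Ideal R)) = {p i}) :
    HasGPIF (Submodule.pi Set.univ (fun i => (p i ^ r i : Ideal R)) :
        Submodule R (Fin n → R)) ⊤
      (∑ i, Multiset.replicate (r i) (p i)) := by
  have h := gpif_pi_pow_aux p hprime hdist r hpow (fun j => primary_aux _ _ (hass j)) _
    (fun _ => 0) (fun _ => Nat.zero_le _) rfl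
  simpa using h
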